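/- Let d ≥ 2, Q ≥ 1, μ₀ = (4π)^{−d} and 0 < c₄ < 1/2. Define 𝒱₂ = ⋃ over integers q with 4μ₀Q ≤ q ≤ 4Q and q ≡ 0 (mod 4), of the sets ⋃_{2 ≤ a_2,…,a_d ≤ q/2, each a_j even} { y′ ∈ [0,2π]^{d−1} : |y_j − 2πa_j/q| < πc₄/(μ₀ Q^{d/(d−1)}) for all j = 2,…,d }. Then the (d−1)-dimensional Lebesgue measure of 𝒱₂ satisfies |𝒱₂| ≥ 2^{−d} · 3^{1−d} · c₄^{d−1}. -/

import Mathlib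

noncomputable section

open MeasureTheory Set
open scoped ENNReal BigOperators

lemma V2_dirichlet (n K : ℕ) (hK : 1 ≤ K) (x : Fin n → ℝ)
    (hx : ∀ j, 0 ≤ x j ∧ x j ≤ 1) :
    ∃ (r : ℕ) (b : Fin n → ℕ), 1 ≤ r ∧ r ≤ K ^ n ∧
      ∀ j, b j ≤ r ∧ |(r : ℝ) * x j - b j| < 1 / K := by
  have hK0 : (0 : ℝ) < K := by exact_mod_cast hK
  let f : ℕ → (Fin n → Fin K) := fun r j =>
    ⟨⌊(K : ℝ) * Int.fract ((r : ℝ) * x j)⌋₊, by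
      rw [Nat.floor_lt (mul_nonneg hK0.le (Int.fract_nonneg _))]
      have := Int.fract_lt_one ((r : ℝ) * x j)
      nlinarith⟩
  have hcard : (Finset.univ : Finset (Fin n → Fin K)).card < (Finset.range (K ^ n + 1)).card := by
    simp
  obtain ⟨r1, h1, r2, h2, hne, heq⟩ :=
    Finset.exists_ne_map_eq_of_card_lt_of_maps_to hcard (f := f) (fun _ _ => by simp)
  wlog hlt : r1 < r2 generalizing r1 r2
  · exact this r2 h2 r1 h1 hne.symm heq.symm (by omega)
  simp only [Finset.mem_range] at h1 h2
  have key : ∀ j, |Int.fract ((r2 : ℝ) * x j) - Int.fract ((r1 : ℝ) * x j)| < 1 / K := by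
    intro j
    have h := congrArg Fin.val (congrFun heq j)
    simp only [f] at h
    have a1 := Nat.floor_le (mul_nonneg hK0.le (Int.fract_nonneg ((r1 : ℝ) * x j)))
    have a2 := Nat.lt_floor_add_one ((K : ℝ) * Int.fract ((r1 : ℝ) * x j))
    have a3 := Nat.floor_le (mul_nonneg hK0.le (Int.fract_nonneg ((r2 : ℝ) * x j)))
    have a4 := Nat.lt_floor_add_one ((K : ℝ) * Int.fract ((r2 : ℝ) * x j))
    rw [h] at a1 a2
    rw [abs_lt, lt_div_iff₀ hK0, neg_lt, lt_div_iff₀ hK0]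
    constructor <;> nlinarith
  have hint : ∀ j, ∃ b : ℕ, b ≤ r2 - r1 ∧ |((r2 - r1 : ℕ) : ℝ) * x j - b| < 1 / K := by
    intro j
    have hk := key j
    have e : Int.fract ((r2 : ℝ) * x j) - Int.fract ((r1 : ℝ) * x j)
        = ((r2 - r1 : ℕ) : ℝ) * x j - ((⌊(r2 : ℝ) * x j⌋ - ⌊(r1 : ℝ) * x j⌋ : ℤ) : ℝ) := by
      rw [Nat.cast_sub hlt.le]
      unfold Int.fract
      push_cast; ring
    rw [e] at hk
    generalize (⌊(r2 : ℝ) * x j⌋ - ⌊(r1 : ℝ) * x j⌋ : ℤ) = z at hk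
    have hK1 : (1 : ℝ) / K ≤ 1 := by
      rw [div_le_one hK0]; exact_mod_cast hK
    have hk' := abs_lt.1 (hk.trans_le hK1)
    have hr : (0 : ℝ) ≤ ((r2 - r1 : ℕ) : ℝ) := by positivity
    have b1 : 0 ≤ ((r2 - r1 : ℕ) : ℝ) * x j := mul_nonneg hr (hx j).1
    have b2 : ((r2 - r1 : ℕ) : ℝ) * x j ≤ ((r2 - r1 : ℕ) : ℝ) := by
      nlinarith [(hx j).2]
    have z1 : (-1 : ℝ) < z := by linarith
    have z2 : (z : ℝ) < ((r2 - r1 : ℕ) : ℝ) + 1 := by linarith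
    have z1' : -1 < z := by exact_mod_cast z1
    have z2' : z < ((r2 - r1 : ℕ) : ℤ) + 1 := by exact_mod_cast z2
    obtain ⟨m, rfl⟩ := Int.eq_ofNat_of_zero_le (by omega : 0 ≤ z)
    refine ⟨m, by omega, by simpa using hk⟩
  choose b hb using hint
  exact ⟨r2 - r1, b, by omega, by omega, hb⟩

lemma V2_count (n : ℕ) (K : ℕ) (hK : 1 ≤ K) (Q t μ c ρ : ℝ) (hQ : 1 ≤ Q)
    (hKQ : (K : ℝ) ^ n ≤ Q) (ht : 0 < t) (htn : t ^ n = Q) (htK : t ≤ 2 * K)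
    (hμ : 0 < μ) (hμ8 : 8 ^ n * μ ≤ 1 / 2) (hc : 0 < c) (hc2 : c < 1 / 2)
    (hρ : ρ = c / (μ * (Q * t))) (C : Finset (Fin n → ℕ))
    (hC : ∀ (r : ℕ) (b : Fin n → ℕ), 1 ≤ r → μ * Q ≤ r → (r : ℝ) ≤ Q →
      (∀ j, 1 ≤ b j ∧ b j ≤ r) → (fun j => ⌊(b j : ℝ) / r / ρ⌋₊) ∈ C) :
    (c / 9) ^ n / 2 ≤ C.card * ρ ^ n := by
  have hK0 : (0 : ℝ) < K := by exact_mod_cast hK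
  have hQ0 : 0 < Q := by linarith
  have hρ0 : 0 < ρ := by rw [hρ]; positivity
  set R : ℝ := 2 * ρ / c with hR
  have hR0 : 0 < R := by positivity
  have hR' : R = 2 / (μ * (Q * t)) := by
    rw [hR, hρ]; field_simp
  let T : (Fin n → ℕ) → Fin n → Set ℝ := fun k j =>
    Icc (k j * ρ - R) ((k j + 1) * ρ + R) ∪ Icc (k j * ρ - R - 1) ((k j + 1) * ρ + R - 1)
  let U : ℕ → Set ℝ := fun r => ⋃ b ∈ Finset.range (r + 1),
    Icc ((b : ℝ) / r - 1 / (r * K)) ((b : ℝ) / r + 1 / (r * K))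
  let S : Finset ℕ := Finset.Icc 1 ⌊μ * Q⌋₊
  have hcover : (univ.pi (fun _ : Fin n => Icc (0 : ℝ) 1)) ⊆
      (⋃ r ∈ S, univ.pi (fun _ : Fin n => U r)) ∪ ⋃ k ∈ C, univ.pi (T k) := by
    intro x hx
    have hx' : ∀ j, 0 ≤ x j ∧ x j ≤ 1 := fun j => hx j (mem_univ j)
    obtain ⟨r, b, hr1, hrK, hb⟩ := V2_dirichlet n K hK x hx'
    have hr0 : (0 : ℝ) < r := by exact_mod_cast hr1
    have hb2 : ∀ j, |x j - (b j : ℝ) / r| < 1 / (r * K) := by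
      intro j
      have h := (hb j).2
      have e : (r : ℝ) * x j - b j = r * (x j - (b j : ℝ) / r) := by field_simp
      rw [e, abs_mul, abs_of_pos hr0] at h
      rw [lt_div_iff₀ (by positivity)]
      rw [lt_div_iff₀ hK0] at h
      linarith
    by_cases hs : (r : ℝ) < μ * Q
    · left
      simp only [mem_iUnion]
      refine ⟨r, Finset.mem_Icc.2 ⟨hr1, Nat.le_floor hs.le⟩, fun j _ => ?_⟩
      simp only [U, mem_iUnion]
      refine ⟨b j, Finset.mem_range.2 (by have := (hb j).1; omega), ?_⟩
      have := abs_lt.1 (hb2 j)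
      constructor <;> linarith
    · right
      push Not at hs
      have hrQ : (r : ℝ) ≤ Q := le_trans (by exact_mod_cast hrK) hKQ
      have hRr : 1 / ((r : ℝ) * K) ≤ R := by
        rw [hR', div_le_div_iff₀ (by positivity) (by positivity)]
        have : μ * Q * t ≤ r * (2 * K) := by gcongr
        linarith
      let b' : Fin n → ℕ := fun j => if b j = 0 then r else b j
      have hmem := hC r b' hr1 hs hrQ (fun j => by
        have := (hb j).1
        simp only [b']; split_ifs <;> omega)
      simp only [mem_iUnion]
      refine ⟨_, hmem, fun j _ => ?_⟩
      have f1 := Nat.floor_le (show 0 ≤ (b' j : ℝ) / r / ρ by positivity)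
      have f2 := Nat.lt_floor_add_one ((b' j : ℝ) / r / ρ)
      rw [le_div_iff₀ hρ0] at f1
      rw [div_lt_iff₀ hρ0] at f2
      have h := abs_lt.1 ((hb2 j).trans_le hRr)
      simp only [T]
      by_cases h0 : b j = 0
      · right
        have e : (b' j : ℝ) / r = 1 := by simp [b', h0, hr0.ne']
        rw [h0] at h
        simp only [Nat.cast_zero, zero_div, sub_zero] at h
        rw [e] at f1 f2 ⊢
        constructor <;> linarith
      · left
        have e : b' j = b j := by simp [b', h0]
        rw [e] at f1 f2 ⊢
        constructor <;> linarith
  have hT : ∀ k, volume (univ.pi (T k)) ≤ ENNReal.ofReal ((9 * ρ / c) ^ n) := by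
    intro k
    rw [volume_pi_pi]
    calc ∏ j, volume (T k j) ≤ ∏ _j : Fin n, ENNReal.ofReal (9 * ρ / c) := by
          apply Finset.prod_le_prod' 
          intro j _
          refine (measure_union_le _ _).trans ?_
          rw [Real.volume_Icc, Real.volume_Icc, ← ENNReal.ofReal_add (by linarith) (by linarith)]
          apply ENNReal.ofReal_le_ofReal
          have : 2 * ρ ≤ ρ / c := by
            rw [le_div_iff₀ hc]; nlinarith
          have e : 9 * ρ / c = 4 * R + ρ / c := by rw [hR]; ring
          rw [e]; linarith
      _ = _ := by
          rw [Finset.prod_const, ← ENNReal.ofReal_pow (by positivity)]; simp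
  have hU : ∀ r ∈ S, volume (univ.pi (fun _ : Fin n => U r)) ≤ ENNReal.ofReal (8 ^ n / Q) := by
    intro r hr
    have hr1 := (Finset.mem_Icc.1 hr).1
    have hr0 : (0 : ℝ) < r := by exact_mod_cast hr1
    have hr1' : (1 : ℝ) ≤ r := by exact_mod_cast hr1
    rw [volume_pi_pi]
    calc ∏ _j : Fin n, volume (U r) ≤ ∏ _j : Fin n, ENNReal.ofReal (8 / t) := by
          apply Finset.prod_le_prod'
          intro j _
          refine (measure_biUnion_finset_le _ _).trans ?_
          have : ∀ b ∈ Finset.range (r + 1),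
              volume (Icc ((b : ℝ) / r - 1 / (r * K)) ((b : ℝ) / r + 1 / (r * K)))
                = ENNReal.ofReal (2 / (r * K)) := by
            intro b _
            rw [Real.volume_Icc]; congr 1; ring
          rw [Finset.sum_congr rfl this, Finset.sum_const, Finset.card_range, nsmul_eq_mul,
            ← ENNReal.ofReal_natCast, ← ENNReal.ofReal_mul (by positivity)]
          apply ENNReal.ofReal_le_ofReal
          push_cast
          rw [mul_div_assoc', div_le_div_iff₀ (by positivity) ht]
          have : ((r : ℝ) + 1) * 2 * t ≤ (2 * r) * 2 * (2 * K) := by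
            gcongr; linarith
          linarith
      _ = _ := by
          rw [Finset.prod_const, ← ENNReal.ofReal_pow (by positivity), Finset.card_univ,
            Fintype.card_fin, div_pow, htn]
  have hmain : ENNReal.ofReal 1 ≤ ENNReal.ofReal (1 / 2 + C.card * (9 * ρ / c) ^ n) := by
    calc ENNReal.ofReal 1 = volume (univ.pi (fun _ : Fin n => Icc (0 : ℝ) 1)) := by
          rw [volume_pi_pi]; simp
      _ ≤ _ := measure_mono hcover
      _ ≤ _ := measure_union_le _ _
      _ ≤ ENNReal.ofReal (1 / 2) + ENNReal.ofReal (C.card * (9 * ρ / c) ^ n) := by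
          gcongr
          · refine (measure_biUnion_finset_le _ _).trans ((Finset.sum_le_sum hU).trans ?_)
            rw [Finset.sum_const, nsmul_eq_mul,
              ← ENNReal.ofReal_natCast, ← ENNReal.ofReal_mul (by positivity)]
            apply ENNReal.ofReal_le_ofReal
            have h1 : ((S.card : ℕ) : ℝ) ≤ μ * Q := by
              simp only [S, Nat.card_Icc, Nat.add_sub_cancel]
              exact Nat.floor_le (by positivity)
            calc (S.card : ℝ) * (8 ^ n / Q) ≤ μ * Q * (8 ^ n / Q) := by gcongr
              _ = 8 ^ n * μ := by field_simp
              _ ≤ _ := hμ8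
          · refine (measure_biUnion_finset_le _ _).trans
              ((Finset.sum_le_sum (fun k _ => hT k)).trans ?_)
            rw [Finset.sum_const, nsmul_eq_mul,
              ← ENNReal.ofReal_natCast, ← ENNReal.ofReal_mul (by positivity)]
      _ = _ := by rw [← ENNReal.ofReal_add (by positivity) (by positivity)]
  have hfin : (1 : ℝ) ≤ 1 / 2 + C.card * (9 * ρ / c) ^ n :=
    (ENNReal.ofReal_le_ofReal_iff (by positivity)).1 hmain
  have e : C.card * ρ ^ n = (c / 9) ^ n * (C.card * (9 * ρ / c) ^ n) := by
    have : ρ ^ n = (c / 9) ^ n * (9 * ρ / c) ^ n := by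
      rw [← mul_pow]; congr 1; field_simp
    rw [this]; ring
  rw [e, div_eq_mul_inv]
  gcongr
  linarith

/-- Disjoint grid cells. -/
lemma V2_cells (n : ℕ) (s : ℝ) (hs : 0 < s) (C : Finset (Fin n → ℕ)) (A : Set (Fin n → ℝ))
    (hA : ∀ k ∈ C, ∀ y : Fin n → ℝ, (∀ j, k j * s ≤ y j ∧ y j < (k j + 1) * s) → y ∈ A) :
    ENNReal.ofReal (C.card * s ^ n) ≤ volume A := by
  let B : (Fin n → ℕ) → Set (Fin n → ℝ) := fun k =>
    univ.pi (fun j => Ico (k j * s) ((k j + 1) * s))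
  have hvol : ∀ k, volume (B k) = ENNReal.ofReal (s ^ n) := by
    intro k
    simp only [B]
    rw [volume_pi_pi]
    have : ∀ j, volume (Ico ((k j : ℝ) * s) ((k j + 1) * s)) = ENNReal.ofReal s := by
      intro j; rw [Real.volume_Ico]; congr 1; ring
    simp only [this]
    rw [Finset.prod_const, ← ENNReal.ofReal_pow hs.le]; simp
  have hdisj : Set.PairwiseDisjoint (C : Set (Fin n → ℕ)) B := by
    intro k _ l _ hkl
    rw [Function.onFun, Set.disjoint_left]
    intro y hk hl
    apply hkl
    ext j
    have a := hk j (mem_univ j)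
    have b := hl j (mem_univ j)
    have h1 : (k j : ℝ) * s < (l j + 1) * s := a.1.trans_lt b.2
    have h2 : (l j : ℝ) * s < (k j + 1) * s := b.1.trans_lt a.2
    have h1' := lt_of_mul_lt_mul_right h1 hs.le
    have h2' := lt_of_mul_lt_mul_right h2 hs.le
    norm_cast at h1' h2'
    omega
  have hmeas : ∀ k ∈ C, MeasurableSet (B k) := fun k _ =>
    MeasurableSet.univ_pi (fun j => measurableSet_Ico)
  calc ENNReal.ofReal (C.card * s ^ n) = ∑ k ∈ C, volume (B k) := by
        simp only [hvol]
        rw [Finset.sum_const, nsmul_eq_mul, ← ENNReal.ofReal_natCast,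
          ← ENNReal.ofReal_mul (by positivity)]
    _ = volume (⋃ k ∈ C, B k) := (measure_biUnion_finset hdisj hmeas).symm
    _ ≤ volume A := by
        apply measure_mono
        intro y hy
        simp only [mem_iUnion] at hy
        obtain ⟨k, hk, hy⟩ := hy
        exact hA k hk y (fun j => hy j (mem_univ j))

lemma V2_core (n : ℕ) (hn : 1 ≤ n) (Q t μ c ρ : ℝ) (hQ : 1 ≤ Q)
    (ht : 1 ≤ t) (htn : t ^ n = Q) 
    (hμ : 0 < μ) (hμ8 : 8 ^ n * μ ≤ 1 / 2) (hc : 0 < c) (hc2 : c < 1 / 2)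
    (hρ : ρ = c / (μ * (Q * t))) (A : Set (Fin n → ℝ))
    (hA : ∀ (r : ℕ) (b : Fin n → ℕ), 1 ≤ r → μ * Q ≤ r → (r : ℝ) ≤ Q →
      (∀ j, 1 ≤ b j ∧ b j ≤ r) → ∀ y : Fin n → ℝ,
      (∀ j, y j ∈ Icc 0 (2 * Real.pi) ∧ |y j - Real.pi * (b j / r)| < Real.pi * ρ) → y ∈ A) :
    ENNReal.ofReal ((c / 6) ^ n / 2) ≤ volume A := by
  classical
  have hpi := Real.pi_gt_three
  have hpi0 := Real.pi_pos
  have hρ0 : 0 < ρ := by rw [hρ]; positivity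
  rcases le_or_gt 1 ρ with h1 | h1
  · -- trivial case
    have hfl : 1 ≤ ⌊Q⌋₊ := Nat.le_floor (by simpa using hQ)
    have hfl' : (1 : ℝ) ≤ ⌊Q⌋₊ := by exact_mod_cast hfl
    have hlt := Nat.lt_floor_add_one Q
    have hμ2 : μ ≤ 1 / 2 := by
      have : (1 : ℝ) ≤ 8 ^ n := one_le_pow₀ (by norm_num)
      nlinarith
    have hμQ : μ * Q ≤ ⌊Q⌋₊ := by nlinarith
    have := V2_cells n Real.pi hpi0 {fun _ => 1} A (by
      intro k hk y hy
      rw [Finset.mem_singleton] at hk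
      subst hk
      refine hA ⌊Q⌋₊ (fun _ => ⌊Q⌋₊) hfl hμQ (Nat.floor_le (by linarith))
        (fun j => ⟨hfl, le_rfl⟩) y (fun j => ?_)
      have hy := hy j
      push_cast at hy
      rw [div_self (by positivity)]
      refine ⟨⟨by linarith, by linarith⟩, ?_⟩
      rw [abs_lt]
      constructor <;> nlinarith)
    refine le_trans (ENNReal.ofReal_le_ofReal ?_) this
    have e1 : (c / 6) ^ n ≤ Real.pi ^ n := by gcongr; linarith
    have : 0 < (c / 6) ^ n := by positivity
    simp only [Finset.card_singleton, Nat.cast_one, one_mul]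
    linarith
  · let L := ⌊1 / ρ⌋₊
    let C : Finset (Fin n → ℕ) := (Fintype.piFinset (fun _ : Fin n => Finset.range (L + 1))).filter
      (fun k => ∃ (r : ℕ) (b : Fin n → ℕ), 1 ≤ r ∧ μ * Q ≤ r ∧ (r : ℝ) ≤ Q ∧
        (∀ j, 1 ≤ b j ∧ b j ≤ r) ∧ k = (fun j => ⌊(b j : ℝ) / r / ρ⌋₊))
    have hK : 1 ≤ ⌊t⌋₊ := Nat.le_floor (by simpa using ht)
    have hK' : (1 : ℝ) ≤ ⌊t⌋₊ := by exact_mod_cast hK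
    have hcount := V2_count n ⌊t⌋₊ hK Q t μ c ρ hQ
      (by rw [← htn]; gcongr; exact Nat.floor_le (by linarith)) (by linarith) htn
      (by have := Nat.lt_floor_add_one t; linarith) hμ hμ8 hc hc2 hρ C (by
        intro r b h1 h2 h3 h4
        simp only [C, Finset.mem_filter, Fintype.mem_piFinset, Finset.mem_range]
        refine ⟨fun j => ?_, r, b, h1, h2, h3, h4, rfl⟩
        rw [Nat.lt_succ_iff]
        apply Nat.floor_le_floor
        gcongr
        have : (0 : ℝ) < r := by exact_mod_cast h1
        rw [div_le_one this]
        exact_mod_cast (h4 j).2)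
    have := V2_cells n (Real.pi * ρ) (by positivity) C A (by
      intro k hk y hy
      simp only [C, Finset.mem_filter] at hk
      obtain ⟨-, r, b, g1, g2, g3, g4, rfl⟩ := hk
      refine hA r b g1 g2 g3 g4 y (fun j => ?_)
      have hy := hy j
      have hr0 : (0 : ℝ) < r := by exact_mod_cast g1
      have f1 := Nat.floor_le (show 0 ≤ (b j : ℝ) / r / ρ by positivity)
      have f2 := Nat.lt_floor_add_one ((b j : ℝ) / r / ρ)
      rw [le_div_iff₀ hρ0] at f1
      rw [div_lt_iff₀ hρ0] at f2
      have hb1 : (b j : ℝ) / r ≤ 1 := by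
        rw [div_le_one hr0]
        exact_mod_cast (g4 j).2
      have hk0 : (0 : ℝ) ≤ (⌊(b j : ℝ) / r / ρ⌋₊ : ℝ) := by positivity
      generalize (⌊(b j : ℝ) / r / ρ⌋₊ : ℝ) = k at *
      generalize (b j : ℝ) / r = p at *
      have u1 := mul_le_mul_of_nonneg_left f1 hpi0.le
      have u2 := mul_lt_mul_of_pos_left f2 hpi0
      have u3 := mul_le_mul_of_nonneg_left hb1 hpi0.le
      have u4 := mul_lt_mul_of_pos_left h1 hpi0
      have u5 : 0 ≤ k * (Real.pi * ρ) := by positivity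
      refine ⟨⟨by linarith, by linarith⟩, ?_⟩
      rw [abs_lt]
      constructor <;> linarith)
    refine le_trans (ENNReal.ofReal_le_ofReal ?_) this
    calc (c / 6) ^ n / 2 ≤ (Real.pi * (c / 9)) ^ n / 2 := by
          gcongr
          nlinarith
      _ = Real.pi ^ n * ((c / 9) ^ n / 2) := by rw [mul_pow]; ring
      _ ≤ Real.pi ^ n * (C.card * ρ ^ n) := by gcongr
      _ = _ := by rw [mul_pow]; ring

/-- Lower bound for the measure of the set `𝒱₂ ⊆ [0,2π]^{d-1}`, the union over
`q ∈ [4μ₀Q, 4Q]` with `4 ∣ q` and even numerators `2 ≤ a_j ≤ q/2` of the cubes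
`{y' : |y_j - 2πa_j/q| < πc₄/(μ₀ Q^{d/(d-1)}) for all j}`, where `μ₀ = (4π)^{-d}`:
`|𝒱₂| ≥ 2^{-d} 3^{1-d} c₄^{d-1}`. -/
theorem V2_measure_lower_bound (d : ℕ) (hd : 2 ≤ d) (Q : ℝ) (hQ : 1 ≤ Q)
    (c₄ : ℝ) (hc₄0 : 0 < c₄) (hc₄ : c₄ < 1 / 2) :
    ENNReal.ofReal ((2 : ℝ) ^ (-(d : ℝ)) * (3 : ℝ) ^ ((1 : ℝ) - (d : ℝ)) * c₄ ^ (d - 1))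
      ≤ volume (⋃ q : ℕ,
          ⋃ (_ : 4 * (4 * Real.pi) ^ (-(d : ℝ)) * Q ≤ (q : ℝ) ∧ (q : ℝ) ≤ 4 * Q ∧
                q % 4 = 0),
          ⋃ a : Fin (d - 1) → ℕ,
          ⋃ (_ : ∀ j, 2 ≤ a j ∧ (a j : ℝ) ≤ (q : ℝ) / 2 ∧ a j % 2 = 0),
          {y : EuclideanSpace ℝ (Fin (d - 1)) | ∀ j, y j ∈ Icc 0 (2 * Real.pi) ∧
            |y j - 2 * Real.pi * (a j : ℝ) / (q : ℝ)| <
              Real.pi * c₄ / ((4 * Real.pi) ^ (-(d : ℝ)) *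
                Q ^ ((d : ℝ) / ((d : ℝ) - 1)))}) := by

  obtain ⟨n, rfl⟩ : ∃ n, d = n + 1 := ⟨d - 1, by omega⟩
  have hn : 1 ≤ n := by omega
  have hn0 : (n : ℝ) ≠ 0 := by positivity
  have hQ0 : 0 < Q := by linarith
  have hpi := Real.pi_gt_three
  have hpi0 := Real.pi_pos
  have hexp : Q ^ (((n + 1 : ℕ) : ℝ) / (((n + 1 : ℕ) : ℝ) - 1)) = Q * Q ^ ((1 : ℝ) / n) := by
    rw [show ((n + 1 : ℕ) : ℝ) / (((n + 1 : ℕ) : ℝ) - 1) = 1 + 1 / n by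
      push_cast; rw [add_sub_cancel_right]; field_simp, Real.rpow_add hQ0, Real.rpow_one]
  rw [hexp]
  have hμe : (4 * Real.pi) ^ (-((n + 1 : ℕ) : ℝ)) = ((4 * Real.pi) ^ (n + 1))⁻¹ := by
    rw [Real.rpow_neg (by positivity), Real.rpow_natCast]
  have hμ : 0 < (4 * Real.pi) ^ (-((n + 1 : ℕ) : ℝ)) := by positivity
  have hμ8 : 8 ^ n * (4 * Real.pi) ^ (-((n + 1 : ℕ) : ℝ)) ≤ 1 / 2 := by
    rw [hμe, ← div_eq_mul_inv, div_le_div_iff₀ (by positivity) (by norm_num), pow_succ]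
    have : (8 : ℝ) ^ n ≤ (4 * Real.pi) ^ n := by gcongr; linarith
    have h0 : (0 : ℝ) < (4 * Real.pi) ^ n := by positivity
    nlinarith
  have ht1 : 1 ≤ Q ^ ((1 : ℝ) / n) := Real.one_le_rpow hQ (by positivity)
  have htn : (Q ^ ((1 : ℝ) / n)) ^ n = Q := by
    rw [one_div, Real.rpow_inv_natCast_pow hQ0.le (by omega)]
  have hlhs : (2 : ℝ) ^ (-((n + 1 : ℕ) : ℝ)) * (3 : ℝ) ^ ((1 : ℝ) - ((n + 1 : ℕ) : ℝ)) *
      c₄ ^ (n + 1 - 1) = (c₄ / 6) ^ n / 2 := by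
    rw [show (1 : ℝ) - ((n + 1 : ℕ) : ℝ) = -(n : ℝ) by push_cast; ring,
      Real.rpow_neg (by norm_num), Real.rpow_neg (by norm_num), Real.rpow_natCast,
      Real.rpow_natCast, Nat.add_sub_cancel, div_pow, show (6 : ℝ) = 2 * 3 by norm_num, mul_pow,
      pow_succ]
    field_simp
  rw [hlhs]
  rw [← (EuclideanSpace.volume_preserving_symm_measurableEquiv_toLp
    (Fin (n + 1 - 1))).symm.measure_preimage_equiv]
  refine V2_core n hn Q _ _ c₄ _ hQ ht1 htn hμ hμ8 hc₄0 hc₄ rfl _ ?_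
  intro r b h1 h2 h3 h4 y hy
  have hr0 : (0 : ℝ) < r := by exact_mod_cast h1
  simp only [mem_preimage, mem_iUnion]
  have e4 : ((4 * r : ℕ) : ℝ) = 4 * r := by push_cast; ring
  refine ⟨4 * r, ⟨by rw [e4]; linarith, by rw [e4]; linarith, by omega⟩,
    fun j => 2 * b j, fun j => ⟨?_, ?_, Nat.mul_mod_right 2 (b j)⟩, fun j => ?_⟩
  · have := (h4 j).1
    show 2 ≤ 2 * b j
    omega
  · have : (b j : ℝ) ≤ r := by exact_mod_cast (h4 j).2
    push_cast; linarith
  · have h := hy j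
    have e : 2 * Real.pi * ((2 * b j : ℕ) : ℝ) / ((4 * r : ℕ) : ℝ) = Real.pi * (b j / r) := by
      push_cast; field_simp; ring
    rw [e, mul_div_assoc]
    exact h
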